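/- arXiv:2505.06214 — 2 statements merged into one kernel-verified Lean document; each statement's English description precedes it below -/
import Mathlib

section
/- If û is a solution of the Fourier-space equation for the parameter ξ with û(0) = û₀ and û'(0) = û₁, then for all t ≥ 0: |û(t)|² ≤ 18 ( |û₁|² / (log²(1 + |ξ|²) + π²) + (1/4)|û₀|² ) e^{-φ(ξ) t}. -/
open MeasureTheory

/-- The weight function φ from the paper. -/
noncomputable def phi {N : ℕ} (ξ : EuclideanSpace ℝ (Fin N)) : ℝ :=
  if ‖ξ‖ ≤ Real.sqrt (Real.exp (4 / 3 : ℝ) - 1) then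
    (2 / 3) * Real.log (1 + ‖ξ‖ ^ 2)
  else
    8 / 9

/-- A solution of `v'' = -ω² v` on `[0, ∞)` is a combination of cosine and sine. -/
theorem harmonic_oscillator_eq {ω : ℝ} (hω : ω ≠ 0) {v v' v'' : ℝ → ℂ}
    (hv : ∀ t, HasDerivAt v (v' t) t) (hv' : ∀ t, HasDerivAt v' (v'' t) t)
    (heq : ∀ t, 0 ≤ t → v'' t = -(ω : ℂ) ^ 2 * v t) {t : ℝ} (ht : 0 ≤ t) :
    v t = (Real.cos (ω * t) : ℂ) * v 0 + ((Real.sin (ω * t) / ω : ℝ) : ℂ) * v' 0 := by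
  have hωc : (ω : ℂ) ≠ 0 := by exact_mod_cast hω
  have hlin (s : ℝ) : HasDerivAt (fun s : ℝ => ω * s) ω s := by
    simpa using (hasDerivAt_id s).const_mul ω
  have hcos (s : ℝ) := (hlin s).cos.ofReal_comp
  have hsin (s : ℝ) := (hlin s).sin.ofReal_comp
  have hP (s : ℝ) := (((hv s).const_mul (ω : ℂ)).mul (hcos s)).sub ((hv' s).mul (hsin s))
  have hQ (s : ℝ) := (((hv s).const_mul (ω : ℂ)).mul (hsin s)).add ((hv' s).mul (hcos s))
  have hPt := constant_of_has_deriv_right_zero (a := 0) (b := t)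
    (fun s _ => (hP s).continuousAt.continuousWithinAt)
    (fun s hs => by
      convert (hP s).hasDerivWithinAt using 1
      rw [heq s hs.1]; push_cast; ring) t ⟨ht, le_rfl⟩
  have hQt := constant_of_has_deriv_right_zero (a := 0) (b := t)
    (fun s _ => (hQ s).continuousAt.continuousWithinAt)
    (fun s hs => by
      convert (hQ s).hasDerivWithinAt using 1
      rw [heq s hs.1]; push_cast; ring) t ⟨ht, le_rfl⟩
  simp only [Pi.mul_apply, Pi.add_apply, Pi.sub_apply, mul_zero, Real.cos_zero, Real.sin_zero,
    Complex.ofReal_one, Complex.ofReal_zero, mul_one, sub_zero, zero_add] at hPt hQt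
  have hone : (Real.sin (ω * t) : ℂ) ^ 2 + (Real.cos (ω * t) : ℂ) ^ 2 = 1 := by
    exact_mod_cast Real.sin_sq_add_cos_sq (ω * t)
  rw [Complex.ofReal_div]
  field_simp
  linear_combination (Real.cos (ω * t) : ℂ) * hPt + (Real.sin (ω * t) : ℂ) * hQt
    - (ω : ℂ) * v t * hone

/-- Solution formula for the damped oscillator `u'' + a u' + (a²/4 + ω²) u = 0` on `[0, ∞)`. -/
theorem damped_oscillator_eq {a ω : ℝ} (hω : ω ≠ 0) {u u' u'' : ℝ → ℂ}
    (hu : ∀ t, HasDerivAt u (u' t) t) (hu' : ∀ t, HasDerivAt u' (u'' t) t)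
    (heq : ∀ t, 0 ≤ t → u'' t + (a : ℂ) * u' t + ((a : ℂ) ^ 2 / 4 + (ω : ℂ) ^ 2) * u t = 0)
    {t : ℝ} (ht : 0 ≤ t) :
    (Real.exp (a / 2 * t) : ℂ) * u t = (Real.cos (ω * t) : ℂ) * u 0
      + ((Real.sin (ω * t) / ω : ℝ) : ℂ) * (u' 0 + (a : ℂ) / 2 * u 0) := by
  have hlin (s : ℝ) : HasDerivAt (fun s : ℝ => a / 2 * s) (a / 2) s := by
    simpa using (hasDerivAt_id s).const_mul (a / 2)
  have hexp (s : ℝ) := (hlin s).exp.ofReal_comp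
  have h := harmonic_oscillator_eq hω
    (v := fun s => (Real.exp (a / 2 * s) : ℂ) * u s)
    (v' := fun s => (Real.exp (a / 2 * s) : ℂ) * (u' s + (a : ℂ) / 2 * u s))
    (v'' := fun s => (Real.exp (a / 2 * s) : ℂ)
      * (u'' s + (a : ℂ) * u' s + (a : ℂ) ^ 2 / 4 * u s))
    (fun s => by
      refine ((hexp s).mul (hu s)).congr_deriv ?_
      push_cast; ring)
    (fun s => by
      refine ((hexp s).mul ((hu' s).add ((hu s).const_mul ((a : ℂ) / 2)))).congr_deriv ?_
      simp only [Pi.add_apply]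
      push_cast; ring)
    (fun s hs => by linear_combination (Real.exp (a / 2 * s) : ℂ) * heq s hs) ht
  simpa using h

theorem quadratic_le_eighteen_mul_exp {x : ℝ} (hx : 0 ≤ x) :
    4 + 4 * x + 2 * x ^ 2 ≤ 18 * Real.exp (x / 3) := by
  have h := Real.sum_le_exp_of_nonneg (x := x / 3) (by positivity) 4
  norm_num [Finset.sum_range_succ, Nat.factorial] at h
  obtain ⟨y, rfl⟩ : ∃ y, x = 3 * y := ⟨x / 3, by ring⟩
  have hy : 0 ≤ y := by linarith
  rw [mul_div_cancel_left₀ y (by norm_num : (3 : ℝ) ≠ 0)] at h ⊢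
  nlinarith [mul_nonneg hy (sq_nonneg (y - 3 / 2)), sq_nonneg (y - 3 / 2)]

theorem abs_sin_mul_div_le {ω t : ℝ} (hω : 0 < ω) (ht : 0 ≤ t) :
    |Real.sin (ω * t) / ω| ≤ t := by
  rw [abs_div, abs_of_pos hω, div_le_iff₀ hω]
  calc |Real.sin (ω * t)| ≤ |ω * t| := Real.abs_sin_le_abs
    _ = t * ω := by rw [abs_of_nonneg (by positivity), mul_comm]

theorem phi_le {N : ℕ} (ξ : EuclideanSpace ℝ (Fin N)) :
    phi ξ ≤ 2 / 3 * Real.log (1 + ‖ξ‖ ^ 2) := by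
  unfold phi
  split_ifs with h
  · exact le_rfl
  · have h2 := (Real.sqrt_lt' ((Real.sqrt_nonneg _).trans_lt (not_le.mp h))).mp (not_le.mp h)
    have h3 : 4 / 3 ≤ Real.log (1 + ‖ξ‖ ^ 2) :=
      (Real.le_log_iff_exp_le (by positivity)).mpr (by linarith)
    linarith

/-- Weighted Cauchy–Schwarz inequality. -/
theorem norm_mul_add_mul_sq_le (p q : ℝ) {m k : ℝ} (hm : 0 < m) (hk : 0 < k) (z w : ℂ) :
    ‖(p : ℂ) * z + (q : ℂ) * w‖ ^ 2
      ≤ (k * p ^ 2 + m * q ^ 2) * (‖w‖ ^ 2 / m + 1 / k * ‖z‖ ^ 2) := by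
  have h1 : ‖(p : ℂ) * z + (q : ℂ) * w‖ ≤ |p| * ‖z‖ + |q| * ‖w‖ := by
    simpa using norm_add_le ((p : ℂ) * z) ((q : ℂ) * w)
  refine (pow_le_pow_left₀ (norm_nonneg _) h1 2).trans ?_
  have h2 : (k * p ^ 2 + m * q ^ 2) * (‖w‖ ^ 2 / m + 1 / k * ‖z‖ ^ 2)
      - (|p| * ‖z‖ + |q| * ‖w‖) ^ 2 = (k * |p| * ‖w‖ - m * |q| * ‖z‖) ^ 2 / (k * m) := by
    rw [← sq_abs p, ← sq_abs q]
    field_simp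
    ring
  have h3 : 0 ≤ (k * |p| * ‖w‖ - m * |q| * ‖z‖) ^ 2 / (k * m) := by positivity
  linarith

/-- Pointwise exponential decay of `|û(t)|²` in the Fourier space. -/
theorem stmt_9 (N : ℕ) (hN : 1 ≤ N) (ξ : EuclideanSpace ℝ (Fin N))
    (a : ℝ) (ha : a = Real.log (1 + ‖ξ‖ ^ 2))
    (u u' u'' : ℝ → ℂ) (u₀ u₁ : ℂ)
    (hu : ∀ t : ℝ, HasDerivAt u (u' t) t)
    (hu' : ∀ t : ℝ, HasDerivAt u' (u'' t) t)
    (heq : ∀ t : ℝ, 0 ≤ t →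
      u'' t + ((a ^ 2 / 4 : ℝ) : ℂ) * u t + ((Real.pi ^ 2 / 4 : ℝ) : ℂ) * u t
        + (a : ℂ) * u' t = 0)
    (h₀ : u 0 = u₀) (h₁ : u' 0 = u₁) :
    ∀ t : ℝ, 0 ≤ t →
      ‖u t‖ ^ 2 ≤
        18 * (‖u₁‖ ^ 2 / (a ^ 2 + Real.pi ^ 2) + (1 / 4) * ‖u₀‖ ^ 2)
          * Real.exp (-(phi ξ) * t) := by
  intro t ht
  have hπ := Real.pi_pos
  have ha0 : 0 ≤ a := ha ▸ Real.log_nonneg (by nlinarith [sq_nonneg ‖ξ‖])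
  have hω : 0 < Real.pi / 2 := by positivity
  have hsol := damped_oscillator_eq (a := a) hω.ne' hu hu'
    (fun s hs => by
      have := heq s hs
      push_cast at this ⊢
      linear_combination this) ht
  have hs := abs_sin_mul_div_le hω ht
  have hcs := Real.sin_sq_add_cos_sq (Real.pi / 2 * t)
  have hsin : Real.sin (Real.pi / 2 * t)
      = Real.pi / 2 * (Real.sin (Real.pi / 2 * t) / (Real.pi / 2)) := by
    field_simp
  have hc := Real.abs_cos_le_one (Real.pi / 2 * t)
  set c := Real.cos (Real.pi / 2 * t)
  set s := Real.sin (Real.pi / 2 * t) / (Real.pi / 2)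
  rw [hsin] at hcs
  have hform : (Real.exp (a / 2 * t) : ℂ) * u t
      = ((c + s * (a / 2) : ℝ) : ℂ) * u₀ + (s : ℂ) * u₁ := by
    rw [hsol, h₀, h₁]; push_cast; ring
  have hCS := norm_mul_add_mul_sq_le (c + s * (a / 2)) s
    (m := a ^ 2 + Real.pi ^ 2) (k := 4) (by positivity) (by norm_num) u₀ u₁
  rw [← hform, norm_mul, Complex.norm_real, Real.norm_of_nonneg (Real.exp_pos _).le, mul_pow,
    ← Real.exp_nat_mul] at hCS
  set D := ‖u₁‖ ^ 2 / (a ^ 2 + Real.pi ^ 2) + (1 / 4) * ‖u₀‖ ^ 2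
  have hD : 0 ≤ D := by positivity
  have has : |a * s| ≤ a * t := by
    rw [abs_mul, abs_of_nonneg ha0]; gcongr
  have hcoef : 4 * (c + s * (a / 2)) ^ 2 + (a ^ 2 + Real.pi ^ 2) * s ^ 2
      ≤ 18 * Real.exp (a * t / 3) := by
    refine le_trans ?_ (quadratic_le_eighteen_mul_exp (mul_nonneg ha0 ht))
    have h1 : c * (a * s) ≤ a * t :=
      calc c * (a * s) ≤ |c * (a * s)| := le_abs_self _
        _ = |c| * |a * s| := abs_mul _ _
        _ ≤ 1 * (a * t) := by gcongr
        _ = a * t := one_mul _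
    have h2 : (a * s) ^ 2 ≤ (a * t) ^ 2 := sq_le_sq' (abs_le.mp has).1 (abs_le.mp has).2
    linarith
  have hphi : phi ξ ≤ 2 / 3 * a := ha ▸ phi_le ξ
  have hexp : Real.exp (a * t / 3)
      ≤ Real.exp ((2 : ℕ) * (a / 2 * t)) * Real.exp (-(phi ξ) * t) := by
    rw [← Real.exp_add, Real.exp_le_exp]
    push_cast
    nlinarith [mul_le_mul_of_nonneg_right hphi ht]
  refine le_of_mul_le_mul_left ?_ (Real.exp_pos ((2 : ℕ) * (a / 2 * t)))
  calc _ ≤ _ := hCS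
    _ ≤ 18 * Real.exp (a * t / 3) * D := by gcongr
    _ ≤ 18 * (Real.exp ((2 : ℕ) * (a / 2 * t)) * Real.exp (-(phi ξ) * t)) * D := by gcongr
    _ = _ := by ring
end

section
/- Let N ≥ 3. Then there exist t₀ > 0 and constants C₁ > 0, C₂ > 0 depending only on N such that for all t ≥ t₀: C₁ t^{-N/2} ≤ ∫_{ℝ^N} (1 + |ξ|²)^{-t} sin²( t √(log(1 + |ξ|²)) ) dξ ≤ C₂ t^{-N/2}. -/
open MeasureTheory

/-- The squared modulus of the leading term, as a function of the radius `r = ‖ξ‖`. -/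
noncomputable def radialProfile (t r : ℝ) : ℝ :=
  (1 + r ^ 2) ^ (-t) * Real.sin (t * Real.sqrt (Real.log (1 + r ^ 2))) ^ 2

lemma radialProfile_nonneg (t r : ℝ) : 0 ≤ radialProfile t r := by
  unfold radialProfile; positivity

lemma radialProfile_le (t r : ℝ) : radialProfile t r ≤ (1 + r ^ 2) ^ (-t) :=
  mul_le_of_le_one_right (by positivity) (Real.sin_sq_le_one _)

lemma continuous_radialProfile (t : ℝ) : Continuous (radialProfile t) := by
  unfold radialProfile
  have h : ∀ r : ℝ, 1 + r ^ 2 ≠ 0 := fun r => by positivity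
  refine Continuous.mul (Continuous.rpow_const (by fun_prop) fun r => Or.inl (h r)) ?_
  have : Continuous fun r : ℝ => Real.log (1 + r ^ 2) := Continuous.log (by fun_prop) h
  fun_prop

lemma integrable_one_add_norm_sq_rpow_neg {N : ℕ} {t : ℝ} (ht : (N : ℝ) < t) :
    Integrable fun ξ : EuclideanSpace ℝ (Fin N) => (1 + ‖ξ‖ ^ 2) ^ (-t) := by
  have h := integrable_rpow_neg_one_add_norm_sq (E := EuclideanSpace ℝ (Fin N)) (μ := volume)
    (r := 2 * t) (by simp only [finrank_euclideanSpace_fin]; linarith [N.cast_nonneg (α := ℝ)])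
  convert h using 3
  ring

lemma integrable_radialProfile_norm {N : ℕ} {t : ℝ} (ht : (N : ℝ) < t) :
    Integrable fun ξ : EuclideanSpace ℝ (Fin N) => radialProfile t ‖ξ‖ := by
  refine (integrable_one_add_norm_sq_rpow_neg ht).mono'
    ((continuous_radialProfile t).comp continuous_norm).aestronglyMeasurable
    (.of_forall fun ξ => ?_)
  rw [Real.norm_of_nonneg (radialProfile_nonneg _ _)]
  exact radialProfile_le _ _

/-- Bernoulli's inequality, in the form used to compare different powers of `1 + r ^ 2`. -/
lemma one_add_sq_rpow_neg_le {m t r : ℝ} (hm : 0 < m) (hmt : m ≤ t) :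
    (1 + r ^ 2) ^ (-t) ≤ (1 + (Real.sqrt (t / m) * r) ^ 2) ^ (-m) := by
  have ht : 0 < t := hm.trans_le hmt
  have hb := one_add_mul_self_le_rpow_one_add (s := r ^ 2) (p := t / m)
    (by linarith [sq_nonneg r]) ((one_le_div hm).2 hmt)
  rw [mul_pow, Real.sq_sqrt (by positivity)]
  calc (1 + r ^ 2) ^ (-t) = ((1 + r ^ 2) ^ (t / m)) ^ (-m) := by
        rw [← Real.rpow_mul (by positivity)]
        congr 1
        field_simp
    _ ≤ _ := Real.rpow_le_rpow_of_nonpos (by positivity) hb (by linarith)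

lemma sqrt_inv_pow_eq_rpow {t : ℝ} (ht : 0 ≤ t) (N : ℕ) :
    (Real.sqrt t ^ N)⁻¹ = t ^ (-(N : ℝ) / 2) := by
  rw [Real.sqrt_eq_rpow, ← Real.rpow_natCast, ← Real.rpow_mul ht, ← Real.rpow_neg ht]
  congr 1
  ring

lemma integral_radialProfile_norm_le (N : ℕ) {m t : ℝ} (hm : (N : ℝ) < m) (hmt : m ≤ t) :
    ∫ ξ : EuclideanSpace ℝ (Fin N), radialProfile t ‖ξ‖ ≤
      (Real.sqrt m ^ N * ∫ ξ : EuclideanSpace ℝ (Fin N), (1 + ‖ξ‖ ^ 2) ^ (-m)) *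
        t ^ (-(N : ℝ) / 2) := by
  have hm0 : 0 < m := N.cast_nonneg.trans_lt hm
  have ht0 : 0 < t := hm0.trans_le hmt
  have hR : 0 < Real.sqrt (t / m) := Real.sqrt_pos.2 (by positivity)
  have hG := integrable_one_add_norm_sq_rpow_neg (N := N) hm
  calc ∫ ξ : EuclideanSpace ℝ (Fin N), radialProfile t ‖ξ‖
      ≤ ∫ ξ : EuclideanSpace ℝ (Fin N), (1 + ‖Real.sqrt (t / m) • ξ‖ ^ 2) ^ (-m) := by
        refine integral_mono (integrable_radialProfile_norm (hm.trans_le hmt))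
          (hG.comp_smul hR.ne') fun ξ => ?_
        simp only [norm_smul, Real.norm_of_nonneg hR.le]
        exact (radialProfile_le _ _).trans (one_add_sq_rpow_neg_le hm0 hmt)
    _ = _ := by
        rw [Measure.integral_comp_smul volume
          (fun ξ : EuclideanSpace ℝ (Fin N) => (1 + ‖ξ‖ ^ 2) ^ (-m)),
          finrank_euclideanSpace_fin, smul_eq_mul, abs_of_nonneg (by positivity),
          ← sqrt_inv_pow_eq_rpow ht0.le, Real.sqrt_div ht0.le, div_pow, inv_div]
        ring

lemma le_sqrt_exp_sq_sub_one {v : ℝ} : v ≤ Real.sqrt (Real.exp (v ^ 2) - 1) :=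
  Real.le_sqrt_of_sq_le (by linarith [Real.add_one_le_exp (v ^ 2)])

lemma hasDerivAt_sqrt_exp_sq_sub_one {v : ℝ} (hv : 0 < v) :
    HasDerivAt (fun v => Real.sqrt (Real.exp (v ^ 2) - 1))
      (v * Real.exp (v ^ 2) / Real.sqrt (Real.exp (v ^ 2) - 1)) v := by
  have h0 : 0 < Real.exp (v ^ 2) - 1 := by
    linarith [Real.add_one_le_exp (v ^ 2), pow_pos hv 2]
  have h := (((hasDerivAt_pow 2 v).exp).sub_const 1).sqrt h0.ne'
  convert h using 1
  have := (Real.sqrt_pos.2 h0).ne'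
  field_simp
  norm_num [mul_comm]

lemma radialProfile_sqrt_exp_sq_sub_one (t : ℝ) {v : ℝ} (hv : 0 ≤ v) :
    radialProfile t (Real.sqrt (Real.exp (v ^ 2) - 1)) =
      Real.exp (-t * v ^ 2) * Real.sin (t * v) ^ 2 := by
  have h0 : 0 ≤ Real.exp (v ^ 2) - 1 := by
    linarith [Real.add_one_le_exp (v ^ 2), sq_nonneg v]
  rw [radialProfile, Real.sq_sqrt h0, add_sub_cancel, Real.log_exp, Real.sqrt_sq hv,
    ← Real.exp_mul]
  congr 2
  ring

/-- Change of variables `r = √(exp (v ^ 2) - 1)`, which linearises the phase. -/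
lemma integral_exp_mul_sin_sq_le (t : ℝ) {n : ℕ} (hn : 1 ≤ n) {a b : ℝ} (ha : 0 < a) (hab : a ≤ b) :
    ∫ v in a..b, v ^ n * (Real.exp (-t * v ^ 2) * Real.sin (t * v) ^ 2) ≤
      ∫ r in Real.sqrt (Real.exp (a ^ 2) - 1)..Real.sqrt (Real.exp (b ^ 2) - 1),
        r ^ n * radialProfile t r := by
  have hpos : ∀ v ∈ Set.uIcc a b, 0 < v := fun v hv =>
    ha.trans_le (Set.uIcc_of_le hab ▸ hv).1
  have hφ : ∀ v ∈ Set.uIcc a b, 0 < Real.sqrt (Real.exp (v ^ 2) - 1) := fun v hv =>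
    (hpos v hv).trans_le le_sqrt_exp_sq_sub_one
  have hφ' : ContinuousOn (fun v => v * Real.exp (v ^ 2) / Real.sqrt (Real.exp (v ^ 2) - 1))
      (Set.uIcc a b) :=
    ContinuousOn.div (by fun_prop) (by fun_prop) fun v hv => (hφ v hv).ne'
  have hg : Continuous fun r => r ^ n * radialProfile t r :=
    (continuous_pow n).mul (continuous_radialProfile t)
  rw [← intervalIntegral.integral_comp_mul_deriv
    (fun v hv => hasDerivAt_sqrt_exp_sq_sub_one (hpos v hv)) hφ' hg]
  refine intervalIntegral.integral_mono_on hab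
    (Continuous.intervalIntegrable (by fun_prop) _ _)
    (ContinuousOn.intervalIntegrable
      ((hg.comp (by fun_prop : Continuous fun v : ℝ =>
        Real.sqrt (Real.exp (v ^ 2) - 1))).continuousOn.mul hφ')) fun v hv => ?_
  rw [← Set.uIcc_of_le hab] at hv
  have hv0 := hpos v hv
  have hφ0 := hφ v hv
  simp only [Function.comp_apply]
  rw [radialProfile_sqrt_exp_sq_sub_one t hv0.le]
  have hle : v ≤ Real.sqrt (Real.exp (v ^ 2) - 1) := le_sqrt_exp_sq_sub_one
  generalize Real.sqrt (Real.exp (v ^ 2) - 1) = w at hφ0 hle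
  obtain ⟨k, rfl⟩ : ∃ k, n = k + 1 := ⟨n - 1, by omega⟩
  have hE : 1 ≤ Real.exp (v ^ 2) := Real.one_le_exp (sq_nonneg v)
  have hpow : v ^ (k + 1) ≤ w ^ k * v * Real.exp (v ^ 2) := by
    rw [pow_succ]
    calc v ^ k * v ≤ w ^ k * v := by gcongr
      _ ≤ _ := le_mul_of_one_le_right (by positivity) hE
  calc v ^ (k + 1) * (Real.exp (-t * v ^ 2) * Real.sin (t * v) ^ 2)
      ≤ w ^ k * v * Real.exp (v ^ 2) * (Real.exp (-t * v ^ 2) * Real.sin (t * v) ^ 2) := by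
        gcongr
    _ = _ := by field_simp; ring

lemma integral_sin_sq_mul_ge {s : ℝ} (hs : 2 ≤ s) :
    s⁻¹ / 4 ≤ ∫ v in s⁻¹..2 * s⁻¹, Real.sin (s ^ 2 * v) ^ 2 := by
  have hs0 : 0 < s := by linarith
  rw [intervalIntegral.integral_comp_mul_left (fun x => Real.sin x ^ 2) (by positivity),
    integral_sin_sq, smul_eq_mul]
  have e1 : s ^ 2 * s⁻¹ = s := by field_simp
  have e2 : s ^ 2 * (2 * s⁻¹) = 2 * s := by field_simp
  rw [e1, e2]
  have h1 : -(1 / 2) ≤ Real.sin s * Real.cos s := by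
    nlinarith [Real.sin_sq_add_cos_sq s, sq_nonneg (Real.sin s + Real.cos s)]
  have h2 : Real.sin (2 * s) * Real.cos (2 * s) ≤ 1 / 2 := by
    nlinarith [Real.sin_sq_add_cos_sq (2 * s), sq_nonneg (Real.sin (2 * s) - Real.cos (2 * s))]
  calc s⁻¹ / 4 = (s ^ 2)⁻¹ * (s / 4) := by field_simp
    _ ≤ (s ^ 2)⁻¹ * ((Real.sin s * Real.cos s - Real.sin (2 * s) * Real.cos (2 * s)
          + 2 * s - s) / 2) := by
      refine mul_le_mul_of_nonneg_left ?_ (by positivity)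
      linarith

lemma integral_pow_mul_exp_mul_sin_sq_ge (n : ℕ) {s : ℝ} (hs : 2 ≤ s) :
    Real.exp (-4) / 4 * (s ^ (n + 1))⁻¹ ≤
      ∫ v in s⁻¹..2 * s⁻¹, v ^ n * (Real.exp (-s ^ 2 * v ^ 2) * Real.sin (s ^ 2 * v) ^ 2) := by
  have hs0 : 0 < s := by linarith
  have hi : 0 < s⁻¹ := by positivity
  calc Real.exp (-4) / 4 * (s ^ (n + 1))⁻¹ = (s⁻¹ ^ n * Real.exp (-4)) * (s⁻¹ / 4) := by
        rw [inv_pow, pow_succ, mul_inv]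
        ring
    _ ≤ (s⁻¹ ^ n * Real.exp (-4)) * ∫ v in s⁻¹..2 * s⁻¹, Real.sin (s ^ 2 * v) ^ 2 := by
        gcongr
        exact integral_sin_sq_mul_ge hs
    _ = ∫ v in s⁻¹..2 * s⁻¹, s⁻¹ ^ n * Real.exp (-4) * Real.sin (s ^ 2 * v) ^ 2 :=
        (intervalIntegral.integral_const_mul _ _).symm
    _ ≤ _ := by
        refine intervalIntegral.integral_mono_on (by linarith)
          (Continuous.intervalIntegrable (by fun_prop) _ _)
          (Continuous.intervalIntegrable (by fun_prop) _ _) fun v hv => ?_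
        have hsv : s * v ≤ 2 := by
          calc s * v ≤ s * (2 * s⁻¹) := by gcongr; exact hv.2
            _ = 2 := by field_simp
        have hsv0 : 0 ≤ s * v := mul_nonneg hs0.le (hi.le.trans hv.1)
        have he : -4 ≤ -s ^ 2 * v ^ 2 := by nlinarith
        have hv1 := hv.1
        have hv0 := hi.le.trans hv1
        rw [mul_assoc]
        gcongr

lemma integral_radialProfile_norm_ge {N : ℕ} (hN : 2 ≤ N) {t : ℝ} (ht : 4 ≤ t)
    (hNt : (N : ℝ) < t) :
    (N * volume.real (Metric.ball (0 : EuclideanSpace ℝ (Fin N)) 1) * (Real.exp (-4) / 4)) *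
      t ^ (-(N : ℝ) / 2) ≤ ∫ ξ : EuclideanSpace ℝ (Fin N), radialProfile t ‖ξ‖ := by
  have ht0 : 0 ≤ t := by linarith
  have : Nontrivial (EuclideanSpace ℝ (Fin N)) :=
    Module.nontrivial_of_finrank_pos (R := ℝ) (by rw [finrank_euclideanSpace_fin]; omega)
  have hint := (integrable_fun_norm_addHaar (volume : Measure (EuclideanSpace ℝ (Fin N)))
    (f := radialProfile t)).1 (integrable_radialProfile_norm hNt)
  rw [integral_fun_norm_addHaar]
  simp only [finrank_euclideanSpace_fin, smul_eq_mul, nsmul_eq_mul] at hint ⊢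
  rw [mul_assoc, mul_assoc]
  gcongr
  have hs : 2 ≤ Real.sqrt t := Real.le_sqrt_of_sq_le (by linarith)
  have hi : 0 < (Real.sqrt t)⁻¹ := by positivity
  have h := integral_pow_mul_exp_mul_sin_sq_ge (N - 1) hs
  rw [Nat.sub_add_cancel (by omega), sqrt_inv_pow_eq_rpow ht0, Real.sq_sqrt ht0] at h
  refine (h.trans (integral_exp_mul_sin_sq_le t (by omega) hi (by linarith))).trans ?_
  rw [intervalIntegral.integral_of_le (by gcongr; linarith)]
  refine setIntegral_mono_set hint ?_ (Set.Ioc_subset_Ioi_self.trans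
    (Set.Ioi_subset_Ioi (Real.sqrt_nonneg _))).eventuallyLE
  filter_upwards [ae_restrict_mem measurableSet_Ioi] with r hr
  exact mul_nonneg (pow_nonneg (Set.mem_Ioi.1 hr).le _) (radialProfile_nonneg _ _)

/-- Theorem 4.1: optimal two-sided `t^{-N/2}` estimate for the leading term. -/
theorem stmt_18 (N : ℕ) (hN : 3 ≤ N) :
    ∃ t₀ > (0 : ℝ), ∃ C₁ > (0 : ℝ), ∃ C₂ > (0 : ℝ), ∀ t : ℝ, t₀ ≤ t →
      C₁ * t ^ (-(N : ℝ) / 2) ≤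
        (∫ ξ : EuclideanSpace ℝ (Fin N),
          (1 + ‖ξ‖ ^ 2) ^ (-t)
            * Real.sin (t * Real.sqrt (Real.log (1 + ‖ξ‖ ^ 2))) ^ 2) ∧
      (∫ ξ : EuclideanSpace ℝ (Fin N),
          (1 + ‖ξ‖ ^ 2) ^ (-t)
            * Real.sin (t * Real.sqrt (Real.log (1 + ‖ξ‖ ^ 2))) ^ 2)
        ≤ C₂ * t ^ (-(N : ℝ) / 2) := by
  have hN' : (3 : ℝ) ≤ N := by exact_mod_cast hN
  have hball : 0 < volume.real (Metric.ball (0 : EuclideanSpace ℝ (Fin N)) 1) :=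
    ENNReal.toReal_pos (Metric.measure_ball_pos _ _ one_pos).ne' measure_ball_lt_top.ne
  have hI : 0 ≤ ∫ ξ : EuclideanSpace ℝ (Fin N), (1 + ‖ξ‖ ^ 2) ^ (-(N + 1 : ℝ)) :=
    integral_nonneg fun ξ => by positivity
  refine ⟨N + 1, by positivity,
    N * volume.real (Metric.ball (0 : EuclideanSpace ℝ (Fin N)) 1) * (Real.exp (-4) / 4),
    by positivity,
    Real.sqrt (N + 1) ^ N * (∫ ξ : EuclideanSpace ℝ (Fin N), (1 + ‖ξ‖ ^ 2) ^ (-(N + 1 : ℝ))) + 1,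
    by positivity, fun t ht => ⟨?_, ?_⟩⟩
  · exact integral_radialProfile_norm_ge (by omega) (by linarith) (by linarith)
  · refine (integral_radialProfile_norm_le N (lt_add_one (N : ℝ)) ht).trans ?_
    have ht0 : 0 ≤ t := by linarith
    gcongr
    exact le_add_of_nonneg_right zero_le_one
end
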